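/- arXiv:0912.2521 — 5 statements merged into one kernel-verified Lean document; each statement's English description precedes it below -/
import Mathlib

section
/- Let μ be a Borel measure on the interval (0,1) satisfying ∫_{(0,1)} (1−β)^{−1} dμ(β) < ∞. Then for every s > 0, ∫₀^∞ (1 − e^{−st}) ( ∫_{(0,1)} β t^{−β−1} dμ(β) ) dt = ∫_{(0,1)} Γ(1−β) s^β dμ(β), and both sides are finite. (That is, the Laplace exponent of the subordinator whose Lévy measure has tail φ_W(t,∞) = ∫_{(0,1)} t^{−β} dμ(β) equals ψ_W(s) = ∫_{(0,1)} s^β Γ(1−β) dμ(β).) -/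
open MeasureTheory Set Real

lemma one_sub_exp_neg_nonneg {x : ℝ} (hx : 0 ≤ x) : 0 ≤ 1 - Real.exp (-x) := by
  simpa using hx

lemma one_sub_exp_neg_le (x : ℝ) : 1 - Real.exp (-x) ≤ x := by
  linarith [Real.add_one_le_exp (-x)]

lemma integrableOn_rpow_neg_mul_exp_neg_mul {β s : ℝ} (hβ : β < 1) (hs : 0 < s) :
    IntegrableOn (fun t : ℝ => t ^ (-β) * Real.exp (-(s * t))) (Ioi 0) := by
  simpa using integrableOn_rpow_mul_exp_neg_mul_rpow (p := 1) (s := -β) (b := s)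
    (by linarith) one_pos hs

/-- The Laplace exponent of the stable Lévy density `β t ^ (-β - 1)` is finite. -/
lemma integrableOn_one_sub_exp_neg_mul_stable {β s : ℝ} (hβ : β ∈ Ioo (0 : ℝ) 1) (hs : 0 < s) :
    IntegrableOn (fun t : ℝ => (1 - Real.exp (-(s * t))) * (β * t ^ (-β - 1))) (Ioi 0) := by
  obtain ⟨h0, h1⟩ := hβ
  have hmeas : Measurable fun t : ℝ => (1 - Real.exp (-(s * t))) * (β * t ^ (-β - 1)) := by
    fun_prop
  rw [← Ioc_union_Ioi_eq_Ioi zero_le_one, integrableOn_union]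
  constructor
  · have hint : IntegrableOn (fun t : ℝ => s * β * t ^ (-β)) (Ioc 0 1) := by
      rw [← intervalIntegrable_iff_integrableOn_Ioc_of_le zero_le_one]
      exact (intervalIntegral.intervalIntegrable_rpow' (by linarith)).const_mul _
    refine hint.mono' hmeas.aestronglyMeasurable ?_
    filter_upwards [ae_restrict_mem measurableSet_Ioc] with t ht
    have ht0 : 0 < t := ht.1
    have hu := one_sub_exp_neg_nonneg (mul_pos hs ht0).le
    rw [Real.norm_of_nonneg (by positivity)]
    calc (1 - Real.exp (-(s * t))) * (β * t ^ (-β - 1))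
        ≤ (s * t) * (β * t ^ (-β - 1)) := by
          gcongr
          exact one_sub_exp_neg_le _
      _ = s * β * t ^ (-β) := by
          rw [Real.rpow_sub_one ht0.ne']
          field_simp
  · have hint : IntegrableOn (fun t : ℝ => β * t ^ (-β - 1)) (Ioi 1) :=
      (integrableOn_Ioi_rpow_of_lt (by linarith) one_pos).const_mul _
    refine hint.mono' hmeas.aestronglyMeasurable ?_
    filter_upwards [ae_restrict_mem measurableSet_Ioi] with t ht
    have ht0 : 0 < t := one_pos.trans ht
    have hu := one_sub_exp_neg_nonneg (mul_pos hs ht0).le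
    rw [Real.norm_of_nonneg (by positivity)]
    exact mul_le_of_le_one_left (by positivity) (by linarith [Real.exp_pos (-(s * t))])

/-- The Laplace exponent of the stable Lévy density `β t ^ (-β - 1)` is `Γ(1 - β) s ^ β`. -/
lemma integral_one_sub_exp_neg_mul_stable {β s : ℝ} (hβ : β ∈ Ioo (0 : ℝ) 1) (hs : 0 < s) :
    ∫ t in Ioi (0 : ℝ), (1 - Real.exp (-(s * t))) * (β * t ^ (-β - 1)) =
      Real.Gamma (1 - β) * s ^ β := by
  have hint := integrableOn_one_sub_exp_neg_mul_stable hβ hs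
  obtain ⟨h0, h1⟩ := hβ
  have hu (t : ℝ) : HasDerivAt (fun t => 1 - Real.exp (-(s * t))) (s * Real.exp (-(s * t))) t := by
    convert! (((hasDerivAt_id t).const_mul s).neg.exp).const_sub 1 using 1
    simp; ring
  have hv (t : ℝ) (ht : t ∈ Ioi (0 : ℝ)) :
      HasDerivAt (fun t : ℝ => -t ^ (-β)) (β * t ^ (-β - 1)) t := by
    convert! (Real.hasDerivAt_rpow_const (p := -β) (Or.inl (ne_of_gt ht))).neg using 1
    ring
  have hu'v (t : ℝ) : s * Real.exp (-(s * t)) * -t ^ (-β) =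
      -s * (t ^ (-β) * Real.exp (-(s * t))) := by ring
  have hzero : Filter.Tendsto ((fun t => 1 - Real.exp (-(s * t))) * fun t : ℝ => -t ^ (-β))
      (nhdsWithin 0 (Ioi 0)) (nhds 0) := by
    have hlim : Filter.Tendsto (fun t : ℝ => s * t ^ (1 - β)) (nhdsWithin 0 (Ioi 0)) (nhds 0) := by
      have hcont : ContinuousAt (fun t : ℝ => s * t ^ (1 - β)) 0 :=
        (Real.continuousAt_rpow_const _ _ (Or.inr (by linarith))).const_mul s
      have := hcont.tendsto
      rw [Real.zero_rpow (by linarith), mul_zero] at this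
      exact this.mono_left nhdsWithin_le_nhds
    refine squeeze_zero_norm' ?_ hlim
    filter_upwards [self_mem_nhdsWithin] with t ht
    have ht0 : 0 < t := ht
    have hnn := one_sub_exp_neg_nonneg (mul_pos hs ht0).le
    rw [Pi.mul_apply, norm_mul, norm_neg, Real.norm_of_nonneg hnn,
      Real.norm_of_nonneg (by positivity)]
    calc (1 - Real.exp (-(s * t))) * t ^ (-β) ≤ (s * t) * t ^ (-β) := by
          gcongr
          exact one_sub_exp_neg_le _
      _ = s * t ^ (1 - β) := by
          rw [sub_eq_add_neg 1 β, Real.rpow_add ht0, Real.rpow_one, mul_assoc]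
  have hinfty : Filter.Tendsto ((fun t => 1 - Real.exp (-(s * t))) * fun t : ℝ => -t ^ (-β))
      Filter.atTop (nhds 0) := by
    refine squeeze_zero_norm' ?_ (tendsto_rpow_neg_atTop h0)
    filter_upwards [Filter.eventually_gt_atTop 0] with t ht
    have hnn := one_sub_exp_neg_nonneg (mul_pos hs ht).le
    rw [Pi.mul_apply, norm_mul, norm_neg, Real.norm_of_nonneg hnn,
      Real.norm_of_nonneg (by positivity)]
    exact mul_le_of_le_one_left (by positivity) (by linarith [Real.exp_pos (-(s * t))])
  rw [integral_Ioi_mul_deriv_eq_deriv_mul (fun t _ => hu t) hv hint ?_ hzero hinfty]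
  · simp_rw [hu'v]
    have hΓ := Real.integral_rpow_mul_exp_neg_mul_Ioi (sub_pos.2 h1) hs
    rw [show 1 - β - 1 = -β by ring] at hΓ
    rw [integral_const_mul, hΓ, one_div, Real.inv_rpow hs.le, Real.rpow_sub hs, Real.rpow_one]
    field_simp
    ring
  · exact ((integrableOn_rpow_neg_mul_exp_neg_mul h1 hs).const_mul (-s)).congr
      (ae_of_all _ fun t => (hu'v t).symm)

lemma Gamma_one_sub_le_inv {β : ℝ} (hβ : β ∈ Ioo (0 : ℝ) 1) :
    Real.Gamma (1 - β) ≤ (1 - β)⁻¹ := by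
  have hpos : 0 < 1 - β := sub_pos.2 hβ.2
  have hle : Real.Gamma (1 - β + 1) ≤ 1 := by
    have h := Real.convexOn_Gamma.2 (x := 1) (y := 2) (by simp) (by simp) hβ.1.le hpos.le
      (by ring)
    simp only [smul_eq_mul, Real.Gamma_one, Real.Gamma_two] at h
    calc Real.Gamma (1 - β + 1) = Real.Gamma (β * 1 + (1 - β) * 2) := by ring_nf
      _ ≤ 1 := h.trans_eq (by ring)
  rw [Real.Gamma_add_one hpos.ne'] at hle
  rwa [← one_div, le_div_iff₀' hpos]

/-- for a Borel measure `μ` on `(0,1)` with `∫ (1−β)⁻¹ dμ(β) < ∞`,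
the Laplace exponent of the subordinator with mixed stable Lévy measure satisfies
`∫₀^∞ (1 − e^{−st}) (∫ β t^{−β−1} dμ(β)) dt = ∫ Γ(1−β) s^β dμ(β)` for all `s > 0`,
and both sides are finite. -/
theorem distributed_levy_laplace_exponent
    (μ : Measure ℝ) (hμsupp : μ (Ioo (0:ℝ) 1)ᶜ = 0)
    (hμfin : ∫⁻ β, ENNReal.ofReal ((1 - β)⁻¹) ∂μ < ⊤) :
    ∀ s : ℝ, 0 < s →
      Integrable (fun β => Real.Gamma (1 - β) * s ^ β) μ ∧
      IntegrableOn (fun t => (1 - Real.exp (-(s * t))) * ∫ β, β * t ^ (-β - 1) ∂μ)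
        (Ioi (0:ℝ)) ∧
      ∫ t in Ioi (0:ℝ), (1 - Real.exp (-(s * t))) * ∫ β, β * t ^ (-β - 1) ∂μ =
        ∫ β, Real.Gamma (1 - β) * s ^ β ∂μ := by
  intro s hs
  have hsupp : ∀ᵐ β ∂μ, β ∈ Ioo (0 : ℝ) 1 := hμsupp
  have hfin : IsFiniteMeasure μ := by
    refine ⟨lt_of_le_of_lt ?_ hμfin⟩
    rw [← lintegral_one]
    refine lintegral_mono_ae ?_
    filter_upwards [hsupp] with β hβ
    rw [ENNReal.one_le_ofReal]
    exact (one_le_inv₀ (sub_pos.2 hβ.2)).2 (by linarith [hβ.1])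
  have hinv : Integrable (fun β : ℝ => (1 - β)⁻¹) μ := by
    refine ⟨by fun_prop, ?_⟩
    rwa [hasFiniteIntegral_iff_ofReal]
    filter_upwards [hsupp] with β hβ
    exact inv_nonneg.2 (sub_pos.2 hβ.2).le
  let f : ℝ → ℝ → ℝ := fun β t => (1 - Real.exp (-(s * t))) * (β * t ^ (-β - 1))
  have hfmeas : AEStronglyMeasurable (Function.uncurry f)
      (μ.prod (volume.restrict (Ioi (0 : ℝ)))) := by
    refine Measurable.aestronglyMeasurable ?_
    simp only [f, Function.uncurry_def]
    fun_prop
  have hfint : ∀ᵐ β ∂μ, ∫ t in Ioi (0 : ℝ), f β t = Real.Gamma (1 - β) * s ^ β := by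
    filter_upwards [hsupp] with β hβ
    exact integral_one_sub_exp_neg_mul_stable hβ hs
  have hnorm : ∀ᵐ β ∂μ, ∫ t in Ioi (0 : ℝ), ‖f β t‖ = Real.Gamma (1 - β) * s ^ β := by
    filter_upwards [hsupp, hfint] with β hβ h
    rw [← h]
    refine setIntegral_congr_fun measurableSet_Ioi fun t ht => ?_
    have ht0 : 0 < t := ht
    have hnn := one_sub_exp_neg_nonneg (mul_pos hs ht0).le
    have hβ0 := hβ.1
    exact Real.norm_of_nonneg (by positivity)
  have hΓ : Integrable (fun β => Real.Gamma (1 - β) * s ^ β) μ := by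
    refine (hinv.mul_const (max 1 s)).mono'
      (hfmeas.integral_prod_right'.congr hfint) ?_
    filter_upwards [hsupp] with β hβ
    have hpos : 0 < 1 - β := sub_pos.2 hβ.2
    have hG := Real.Gamma_pos_of_pos hpos
    rw [Real.norm_of_nonneg (by positivity)]
    gcongr
    · exact Gamma_one_sub_le_inv hβ
    · calc s ^ β ≤ (max 1 s) ^ β := Real.rpow_le_rpow hs.le (le_max_right _ _) hβ.1.le
        _ ≤ max 1 s := Real.rpow_le_self_of_one_le (le_max_left _ _) hβ.2.le
  have hprod : Integrable (Function.uncurry f) (μ.prod (volume.restrict (Ioi (0 : ℝ)))) := by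
    rw [integrable_prod_iff hfmeas]
    refine ⟨?_, hΓ.congr (hnorm.mono fun _ h => h.symm)⟩
    filter_upwards [hsupp] with β hβ
    exact integrableOn_one_sub_exp_neg_mul_stable hβ hs
  simp_rw [← integral_const_mul]
  exact ⟨hΓ, hprod.integral_prod_right,
    (integral_integral_swap hprod).symm.trans (integral_congr_ae hfint)⟩
end

section
/- Let ν be a finite Borel measure on (0,1), let 0 < β₀ ≤ β₁ < 1, let c₀, c₁ ≥ 0, and let u : [0,∞) → ℝ be continuous on [0,∞) and differentiable on (0,∞) with |u′(t)| ≤ c₁ t^{β₁−1} + c₀ t^{β₀−1} for all t > 0. Then for every s > 0, the Laplace transform of the distributed-order fractional derivative satisfies ∫₀^∞ e^{−st} 𝔻^{(ν)}u(t) dt = ( ũ(s) − u(0)/s ) ψ(s), where ũ(s) = ∫₀^∞ e^{−st} u(t) dt and ψ(s) = ∫_{(0,1)} s^β dν(β). -/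
open MeasureTheory Set Real

/-- The Caputo fractional derivative of order `β ∈ (0,1)`:
`∂^β u(t)/∂t^β = (1/Γ(1−β)) ∫₀ᵗ u′(r) (t−r)^{−β} dr`. -/
noncomputable def caputoDeriv (β : ℝ) (u : ℝ → ℝ) (t : ℝ) : ℝ :=
  (1 / Real.Gamma (1 - β)) * ∫ r in Ioo (0:ℝ) t, deriv u r * (t - r) ^ (-β)

/-- The distributed-order fractional derivative `𝔻^{(ν)} u(t) = ∫ ∂^β u/∂t^β dν(β)`. -/
noncomputable def distributedOrderDeriv (ν : Measure ℝ) (u : ℝ → ℝ) (t : ℝ) : ℝ :=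
  ∫ β, caputoDeriv β u t ∂ν

theorem measurable_inv_Gamma : Measurable fun x : ℝ => (Real.Gamma x)⁻¹ := by
  have h : (fun x : ℝ => (Real.Gamma x)⁻¹) = fun x : ℝ => ((Complex.Gamma x)⁻¹).re := by
    ext x
    rw [Complex.Gamma_ofReal, ← Complex.ofReal_inv, Complex.ofReal_re]
  rw [h]
  exact (Complex.continuous_re.comp
    (Complex.differentiable_one_div_Gamma.continuous.comp Complex.continuous_ofReal)).measurable

theorem integrableOn_rpow_mul_exp_neg_mul {a s : ℝ} (ha : -1 < a) (hs : 0 < s) :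
    IntegrableOn (fun t : ℝ => t ^ a * Real.exp (-(s * t))) (Ioi 0) := by
  simpa using integrableOn_rpow_mul_exp_neg_mul_rpow ha one_pos hs

/-- The exponentially damped Abel kernel `w ↦ w^{-β} e^{-sw}`, extended by zero to `w ≤ 0`. -/
noncomputable def dampedAbelKernel (s β w : ℝ) : ℝ :=
  (Ioi (0 : ℝ)).indicator (fun w => w ^ (-β) * Real.exp (-(s * w))) w

theorem dampedAbelKernel_nonneg (s β w : ℝ) : 0 ≤ dampedAbelKernel s β w :=
  indicator_nonneg (fun _ hx => mul_nonneg (rpow_nonneg (le_of_lt hx) _) (exp_pos _).le) _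

theorem measurable_dampedAbelKernel (s : ℝ) :
    Measurable fun p : ℝ × ℝ => dampedAbelKernel s p.1 p.2 := by
  have h : (fun p : ℝ × ℝ => dampedAbelKernel s p.1 p.2) =
      {p : ℝ × ℝ | p.2 ∈ Ioi (0 : ℝ)}.indicator
        (fun p => p.2 ^ (-p.1) * Real.exp (-(s * p.2))) := rfl
  rw [h]
  exact Measurable.indicator (by fun_prop) (measurable_snd measurableSet_Ioi)

theorem integrable_dampedAbelKernel {s β : ℝ} (hs : 0 < s) (hβ : β < 1) :
    Integrable (dampedAbelKernel s β) :=
  (integrableOn_rpow_mul_exp_neg_mul (by linarith) hs).integrable_indicator measurableSet_Ioi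

theorem integral_dampedAbelKernel {s β : ℝ} (hs : 0 < s) (hβ : β < 1) :
    ∫ w, dampedAbelKernel s β w = s ^ (β - 1) * Real.Gamma (1 - β) := by
  have h := Real.integral_rpow_mul_exp_neg_mul_Ioi (sub_pos.2 hβ) hs
  rw [show 1 - β - 1 = -β by ring, one_div, inv_rpow hs.le, ← rpow_neg hs.le, neg_sub] at h
  rw [← h]
  exact integral_indicator measurableSet_Ioi

theorem exp_mul_dampedAbelKernel_sub (s β r t : ℝ) :
    Real.exp (-(s * r)) * dampedAbelKernel s β (t - r) =
      (Iio t).indicator (fun r => Real.exp (-(s * t)) * (t - r) ^ (-β)) r := by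
  by_cases h : r < t
  · rw [dampedAbelKernel, indicator_of_mem (show t - r ∈ Ioi 0 from sub_pos.2 h),
      indicator_of_mem (show r ∈ Iio t from h), mul_left_comm, ← Real.exp_add, mul_comm]
    congr 2
    ring
  · rw [dampedAbelKernel, indicator_of_notMem (by simpa using h),
      indicator_of_notMem (by simpa using h), mul_zero]

/-- The integrand of the iterated integral defining the Laplace transform of
`distributedOrderDeriv ν u`, as a function of `((β, r), t)`. -/
noncomputable def laplaceIntegrand (s : ℝ) (u : ℝ → ℝ) (p : ℝ × ℝ) (t : ℝ) : ℝ :=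
  (Real.Gamma (1 - p.1))⁻¹ * (Real.exp (-(s * p.2)) * deriv u p.2) *
    dampedAbelKernel s p.1 (t - p.2)

theorem measurable_laplaceIntegrand (s : ℝ) (u : ℝ → ℝ) :
    Measurable (Function.uncurry (laplaceIntegrand s u)) := by
  have hΓ : Measurable fun q : (ℝ × ℝ) × ℝ => (Real.Gamma (1 - q.1.1))⁻¹ :=
    measurable_inv_Gamma.comp (by fun_prop)
  have hu : Measurable fun q : (ℝ × ℝ) × ℝ => deriv u q.1.2 :=
    (measurable_deriv u).comp (by fun_prop)
  have hK : Measurable fun q : (ℝ × ℝ) × ℝ => dampedAbelKernel s q.1.1 (q.2 - q.1.2) :=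
    (measurable_dampedAbelKernel s).comp
      (f := fun q : (ℝ × ℝ) × ℝ => (q.1.1, q.2 - q.1.2)) (by fun_prop)
  exact (hΓ.mul (Measurable.mul (by fun_prop) hu)).mul hK

theorem integral_laplaceIntegrand {s β : ℝ} (hs : 0 < s) (hβ : β < 1) (u : ℝ → ℝ) (r : ℝ) :
    ∫ t, laplaceIntegrand s u (β, r) t =
      s ^ (β - 1) * (Real.exp (-(s * r)) * deriv u r) := by
  have hΓ := (Real.Gamma_pos_of_pos (sub_pos.2 hβ)).ne'
  simp only [laplaceIntegrand]
  rw [integral_const_mul, integral_sub_right_eq_self (dampedAbelKernel s β),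
    integral_dampedAbelKernel hs hβ]
  field_simp

theorem integral_norm_laplaceIntegrand {s β : ℝ} (hs : 0 < s) (hβ : β < 1) (u : ℝ → ℝ) (r : ℝ) :
    ∫ t, ‖laplaceIntegrand s u (β, r) t‖ =
      s ^ (β - 1) * ‖Real.exp (-(s * r)) * deriv u r‖ := by
  have hΓ := Real.Gamma_pos_of_pos (sub_pos.2 hβ)
  simp only [laplaceIntegrand]
  simp_rw [norm_mul _ (dampedAbelKernel s _ _), Real.norm_of_nonneg (dampedAbelKernel_nonneg s _ _)]
  rw [integral_const_mul, integral_sub_right_eq_self (dampedAbelKernel s β),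
    integral_dampedAbelKernel hs hβ, norm_mul, Real.norm_of_nonneg (inv_nonneg.2 hΓ.le)]
  field_simp

theorem integrable_rpow_of_ae_mem_Ioo {ν : Measure ℝ} [IsFiniteMeasure ν]
    (hν : ∀ᵐ β ∂ν, β ∈ Ioo (0 : ℝ) 1) {s : ℝ} (hs : 0 < s) :
    Integrable (fun β : ℝ => s ^ (β - 1)) ν := by
  refine Integrable.of_bound (C := max 1 s⁻¹)
    (by fun_prop : Measurable fun β : ℝ => s ^ (β - 1)).aestronglyMeasurable ?_
  filter_upwards [hν] with β hβ
  rw [Real.norm_of_nonneg (rpow_nonneg hs.le _)]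
  rcases le_total 1 s with h | h
  · exact le_max_of_le_left (rpow_le_one_of_one_le_of_nonpos h (by linarith [hβ.2]))
  · refine le_max_of_le_right ?_
    rw [← rpow_neg_one]
    exact rpow_le_rpow_of_exponent_ge hs h (by linarith [hβ.1])

theorem ae_fst_lt_one {ν : Measure ℝ} [IsFiniteMeasure ν]
    (hν : ∀ᵐ β ∂ν, β ∈ Ioo (0 : ℝ) 1) :
    ∀ᵐ p ∂ν.prod (volume.restrict (Ioi (0 : ℝ))), p.1 < 1 := by
  filter_upwards [Measure.quasiMeasurePreserving_fst.ae hν] with p hp using hp.2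

theorem integrable_uncurry_laplaceIntegrand {ν : Measure ℝ} [IsFiniteMeasure ν]
    (hν : ∀ᵐ β ∂ν, β ∈ Ioo (0 : ℝ) 1) {s : ℝ} (hs : 0 < s) {u : ℝ → ℝ}
    (hu : IntegrableOn (fun r => Real.exp (-(s * r)) * deriv u r) (Ioi 0)) :
    Integrable (Function.uncurry (laplaceIntegrand s u))
      ((ν.prod (volume.restrict (Ioi (0 : ℝ)))).prod volume) := by
  rw [integrable_prod_iff (measurable_laplaceIntegrand s u).aestronglyMeasurable]
  constructor
  · filter_upwards [ae_fst_lt_one hν] with p hp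
    exact ((integrable_dampedAbelKernel hs hp).comp_sub_right p.2).const_mul
      ((Real.Gamma (1 - p.1))⁻¹ * (Real.exp (-(s * p.2)) * deriv u p.2))
  · refine ((integrable_rpow_of_ae_mem_Ioo hν hs).mul_prod hu.norm).congr ?_
    filter_upwards [ae_fst_lt_one hν] with p hp
    exact (integral_norm_laplaceIntegrand hs hp u p.2).symm

theorem integral_laplaceIntegrand_eq_caputoDeriv (s β t : ℝ) (u : ℝ → ℝ) :
    ∫ r in Ioi (0 : ℝ), laplaceIntegrand s u (β, r) t =
      Real.exp (-(s * t)) * caputoDeriv β u t := by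
  have h : ∀ r, laplaceIntegrand s u (β, r) t =
      (Iio t).indicator (fun r => (Real.Gamma (1 - β))⁻¹ * Real.exp (-(s * t)) *
        (deriv u r * (t - r) ^ (-β))) r := by
    intro r
    have h' := exp_mul_dampedAbelKernel_sub s β r t
    simp only [laplaceIntegrand]
    rw [show ∀ a b c d : ℝ, a * (b * c) * d = a * c * (b * d) by intros; ring, h']
    by_cases hr : r ∈ Iio t
    · rw [indicator_of_mem hr, indicator_of_mem hr]
      ring
    · rw [indicator_of_notMem hr, indicator_of_notMem hr, mul_zero]
  simp_rw [h]
  rw [setIntegral_indicator measurableSet_Iio, Ioi_inter_Iio, integral_const_mul, caputoDeriv]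
  ring

theorem laplace_distributedOrderDeriv_eq {ν : Measure ℝ} [IsFiniteMeasure ν]
    (hν : ∀ᵐ β ∂ν, β ∈ Ioo (0 : ℝ) 1) {s : ℝ} (hs : 0 < s) {u : ℝ → ℝ}
    (hu : IntegrableOn (fun r => Real.exp (-(s * r)) * deriv u r) (Ioi 0)) :
    ∫ t in Ioi (0 : ℝ), Real.exp (-(s * t)) * distributedOrderDeriv ν u t =
      (∫ β, s ^ (β - 1) ∂ν) * ∫ r in Ioi (0 : ℝ), Real.exp (-(s * r)) * deriv u r := by
  have hF := integrable_uncurry_laplaceIntegrand hν hs hu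
  have hzero : ∀ t, t ∉ Ioi (0 : ℝ) →
      Real.exp (-(s * t)) * distributedOrderDeriv ν u t = 0 := by
    intro t ht
    simp [distributedOrderDeriv, caputoDeriv, Ioo_eq_empty (show ¬ 0 < t from ht)]
  calc ∫ t in Ioi (0 : ℝ), Real.exp (-(s * t)) * distributedOrderDeriv ν u t
      = ∫ t, Real.exp (-(s * t)) * distributedOrderDeriv ν u t :=
        setIntegral_eq_integral_of_forall_compl_eq_zero hzero
    _ = ∫ t, ∫ p, laplaceIntegrand s u p t ∂ν.prod (volume.restrict (Ioi (0 : ℝ))) := by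
        refine integral_congr_ae ?_
        filter_upwards [hF.prod_left_ae] with t ht
        refine Eq.trans ?_ (integral_prod _ ht).symm
        simp only [Function.uncurry_apply_pair, integral_laplaceIntegrand_eq_caputoDeriv,
          integral_const_mul, distributedOrderDeriv]
    _ = ∫ p, (∫ t, laplaceIntegrand s u p t) ∂ν.prod (volume.restrict (Ioi (0 : ℝ))) :=
        (integral_integral_swap hF).symm
    _ = ∫ p, s ^ (p.1 - 1) * (Real.exp (-(s * p.2)) * deriv u p.2)
          ∂ν.prod (volume.restrict (Ioi (0 : ℝ))) := by
        refine integral_congr_ae ?_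
        filter_upwards [ae_fst_lt_one hν] with p hp
        exact integral_laplaceIntegrand hs hp u p.2
    _ = _ := integral_prod_mul (fun β : ℝ => s ^ (β - 1))
          (fun r : ℝ => Real.exp (-(s * r)) * deriv u r)

theorem integrableOn_exp_mul_deriv {s a b c d : ℝ} (hs : 0 < s) (ha : 0 < a) (hb : 0 < b)
    {u : ℝ → ℝ}
    (hbound : ∀ t : ℝ, 0 < t → |deriv u t| ≤ c * t ^ (b - 1) + d * t ^ (a - 1)) :
    IntegrableOn (fun r => Real.exp (-(s * r)) * deriv u r) (Ioi 0) := by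
  have hdom := ((integrableOn_rpow_mul_exp_neg_mul (a := b - 1) (by linarith) hs).const_mul c).add
    ((integrableOn_rpow_mul_exp_neg_mul (a := a - 1) (by linarith) hs).const_mul d)
  refine Integrable.mono' hdom
    (Measurable.mul (by fun_prop) (measurable_deriv u)).aestronglyMeasurable ?_
  filter_upwards [ae_restrict_mem measurableSet_Ioi] with t ht
  rw [norm_mul, Real.norm_of_nonneg (exp_pos _).le, Real.norm_eq_abs]
  calc _ ≤ Real.exp (-(s * t)) * (c * t ^ (b - 1) + d * t ^ (a - 1)) :=
        mul_le_mul_of_nonneg_left (hbound t ht) (exp_pos _).le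
    _ = _ := by simp only [Pi.add_apply]; ring

theorem abs_sub_le_of_abs_deriv_le_rpow {a b c d : ℝ} (ha : 0 < a) (hb : 0 < b)
    {u : ℝ → ℝ} (hu : ContinuousOn u (Ici 0)) (hu' : DifferentiableOn ℝ u (Ioi 0))
    (hbound : ∀ t : ℝ, 0 < t → |deriv u t| ≤ c * t ^ (b - 1) + d * t ^ (a - 1))
    {t : ℝ} (ht : 0 ≤ t) :
    |u t - u 0| ≤ c * (t ^ b / b) + d * (t ^ a / a) := by
  have hb' : IntervalIntegrable (fun x : ℝ => c * x ^ (b - 1)) volume 0 t :=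
    (intervalIntegral.intervalIntegrable_rpow' (by linarith)).const_mul c
  have ha' : IntervalIntegrable (fun x : ℝ => d * x ^ (a - 1)) volume 0 t :=
    (intervalIntegral.intervalIntegrable_rpow' (by linarith)).const_mul d
  have hle : ∀ᵐ x : ℝ, x ∈ Ioc 0 t → ‖deriv u x‖ ≤ c * x ^ (b - 1) + d * x ^ (a - 1) :=
    .of_forall fun x hx => hbound x hx.1
  have hui : IntervalIntegrable (deriv u) volume 0 t := by
    refine (hb'.add ha').mono_fun' (measurable_deriv u).aestronglyMeasurable ?_
    rw [uIoc_of_le ht]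
    exact (ae_restrict_iff' measurableSet_Ioc).2 hle
  have hftc := intervalIntegral.integral_eq_sub_of_hasDerivAt_of_le ht
    (hu.mono Icc_subset_Ici_self)
    (fun x hx => (hu'.differentiableAt (Ioi_mem_nhds hx.1)).hasDerivAt) hui
  rw [← hftc, ← Real.norm_eq_abs]
  refine (intervalIntegral.norm_integral_le_of_norm_le ht hle (hb'.add ha')).trans_eq ?_
  rw [intervalIntegral.integral_add hb' ha', intervalIntegral.integral_const_mul,
    intervalIntegral.integral_const_mul, integral_rpow (.inl (by linarith)),
    integral_rpow (.inl (by linarith))]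
  simp [ha.ne', hb.ne']

theorem integrableOn_exp_mul_of_abs_deriv_le_rpow {s a b c d : ℝ} (hs : 0 < s) (ha : 0 < a)
    (hb : 0 < b) {u : ℝ → ℝ} (hu : ContinuousOn u (Ici 0)) (hu' : DifferentiableOn ℝ u (Ioi 0))
    (hbound : ∀ t : ℝ, 0 < t → |deriv u t| ≤ c * t ^ (b - 1) + d * t ^ (a - 1)) :
    IntegrableOn (fun t => Real.exp (-(s * t)) * u t) (Ioi 0) := by
  have hdom :=
    (((integrableOn_rpow_mul_exp_neg_mul (a := 0) (by norm_num) hs).const_mul |u 0|).add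
    ((integrableOn_rpow_mul_exp_neg_mul (a := b) (by linarith) hs).const_mul (c / b))).add
    ((integrableOn_rpow_mul_exp_neg_mul (a := a) (by linarith) hs).const_mul (d / a))
  refine Integrable.mono' hdom (ContinuousOn.aestronglyMeasurable
    (ContinuousOn.mul (by fun_prop) (hu.mono Ioi_subset_Ici_self)) measurableSet_Ioi) ?_
  filter_upwards [ae_restrict_mem measurableSet_Ioi] with t ht
  rw [norm_mul, Real.norm_of_nonneg (exp_pos _).le, Real.norm_eq_abs]
  have h := abs_sub_le_of_abs_deriv_le_rpow ha hb hu hu' hbound (le_of_lt ht)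
  have h' : |u t| ≤ |u 0| + (c * (t ^ b / b) + d * (t ^ a / a)) := by
    linarith [abs_sub_abs_le_abs_sub (u t) (u 0)]
  refine (mul_le_mul_of_nonneg_left h' (exp_pos _).le).trans_eq ?_
  simp only [Pi.add_apply, rpow_zero]
  ring

/-- The Laplace transform of a derivative. -/
theorem integral_exp_mul_deriv {s : ℝ} {u : ℝ → ℝ}
    (hu : ContinuousOn u (Ici 0)) (hu' : DifferentiableOn ℝ u (Ioi 0))
    (hui : IntegrableOn (fun t => Real.exp (-(s * t)) * u t) (Ioi 0))
    (hui' : IntegrableOn (fun t => Real.exp (-(s * t)) * deriv u t) (Ioi 0)) :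
    ∫ t in Ioi (0 : ℝ), Real.exp (-(s * t)) * deriv u t =
      s * (∫ t in Ioi (0 : ℝ), Real.exp (-(s * t)) * u t) - u 0 := by
  have hderiv : ∀ t ∈ Ioi (0 : ℝ), HasDerivAt (fun t => Real.exp (-(s * t)) * u t)
      (Real.exp (-(s * t)) * deriv u t - s * (Real.exp (-(s * t)) * u t)) t := by
    intro t ht
    have h1 := (hu'.differentiableAt (Ioi_mem_nhds ht)).hasDerivAt
    have h2 : HasDerivAt (fun t => Real.exp (-(s * t))) (Real.exp (-(s * t)) * (-(s * 1))) t :=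
      ((hasDerivAt_id' t).const_mul s).neg.exp
    exact (h2.mul h1).congr_deriv (by ring)
  have hdiff := hui'.sub (hui.const_mul s)
  have hlim := tendsto_zero_of_hasDerivAt_of_integrableOn_Ioi hderiv hdiff hui
  have hcont : ContinuousWithinAt (fun t => Real.exp (-(s * t)) * u t) (Ici 0) 0 :=
    ContinuousWithinAt.mul (by fun_prop) (hu 0 self_mem_Ici)
  have h := integral_Ioi_of_hasDerivAt_of_tendsto hcont hderiv hdiff hlim
  rw [integral_sub hui' (hui.const_mul s), integral_const_mul] at h
  simp only [mul_zero, neg_zero, Real.exp_zero, one_mul] at h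
  linarith

/-- Laplace transform of the distributed-order fractional derivative:
`∫₀^∞ e^{−st} 𝔻^{(ν)}u(t) dt = (ũ(s) − u(0)/s) ψ(s)`, with `ψ(s) = ∫ s^β dν(β)`. -/
theorem distributed_order_laplace_transform
    (ν : Measure ℝ) [IsFiniteMeasure ν] (hνsupp : ν (Ioo (0:ℝ) 1)ᶜ = 0)
    (β₀ β₁ : ℝ) (h0 : 0 < β₀) (h01 : β₀ ≤ β₁) (h1 : β₁ < 1)
    (c₀ c₁ : ℝ) (hc₀ : 0 ≤ c₀) (hc₁ : 0 ≤ c₁)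
    (u : ℝ → ℝ) (hu : ContinuousOn u (Ici 0))
    (hu' : DifferentiableOn ℝ u (Ioi 0))
    (hbound : ∀ t : ℝ, 0 < t → |deriv u t| ≤ c₁ * t ^ (β₁ - 1) + c₀ * t ^ (β₀ - 1)) :
    ∀ s : ℝ, 0 < s →
      ∫ t in Ioi (0:ℝ), Real.exp (-(s * t)) * distributedOrderDeriv ν u t =
        ((∫ t in Ioi (0:ℝ), Real.exp (-(s * t)) * u t) - u 0 / s) * ∫ β, s ^ β ∂ν := by
  intro s hs
  have hν : ∀ᵐ β ∂ν, β ∈ Ioo (0 : ℝ) 1 := mem_ae_iff.2 hνsupp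
  have hb : 0 < β₁ := h0.trans_le h01
  have hui := integrableOn_exp_mul_of_abs_deriv_le_rpow hs h0 hb hu hu' hbound
  have hui' := integrableOn_exp_mul_deriv hs h0 hb hbound
  rw [laplace_distributedOrderDeriv_eq hν hs hui', integral_exp_mul_deriv hu hu' hui hui']
  simp_rw [rpow_sub_one hs.ne', integral_div]
  field_simp
end

section
/- Let 0 < β₀ ≤ β₁ < 1, let p : (0,1) → ℝ be a nonnegative integrable function vanishing outside [β₀,β₁], and assume C = ∫_{β₀}^{β₁} sin(βπ) Γ(1−β) p(β) dβ > 0. Define A(r) = ∫₀¹ r^β sin(βπ) Γ(1−β) p(β) dβ and B(r) = ∫₀¹ r^β cos(βπ) Γ(1−β) p(β) dβ for r > 0. Then for every λ > 0 and t > 0, (λ/π) ∫₀^∞ e^{−tr} A(r) / ( (B(r)+λ)² + A(r)² ) dr ≤ λ k(t), where k(t) = (Cπ)^{−1} ( Γ(1−β₁) t^{β₁−1} + Γ(1−β₀) t^{β₀−1} ). -/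
open MeasureTheory Set Real

/-- For `r > 0` and `b` between `a` and `c`, the power `r ^ b` dominates the smaller of
`r ^ a` and `r ^ c`. -/
theorem one_le_rpow_mul_rpow_neg_add_rpow_neg {a b c r : ℝ} (hr : 0 < r) (hab : a ≤ b)
    (hbc : b ≤ c) : 1 ≤ r ^ b * (r ^ (-c) + r ^ (-a)) := by
  rw [mul_add, ← rpow_add hr, ← rpow_add hr]
  have hc := rpow_pos_of_pos hr (b + -c)
  have ha := rpow_pos_of_pos hr (b + -a)
  rcases le_total r 1 with h | h
  · linarith [one_le_rpow_of_pos_of_le_one_of_nonpos hr h (show b + -c ≤ 0 by linarith)]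
  · linarith [one_le_rpow h (show 0 ≤ b + -a by linarith)]

/-- If `p` is integrable on `[a, b] ⊆ (-∞, 1)`, so is its product with
`r ^ x * sin (x * π) * Γ (1 - x)`. -/
theorem integrableOn_rpow_mul_sin_mul_Gamma_mul {a b r : ℝ} {p : ℝ → ℝ} (hb : b < 1) (hr : 0 < r)
    (hp : IntegrableOn p (Icc a b)) :
    IntegrableOn (fun x => r ^ x * Real.sin (x * π) * Real.Gamma (1 - x) * p x) (Icc a b) := by
  refine IntegrableOn.continuousOn_mul ?_ hp isCompact_Icc
  have hΓ : ContinuousOn (fun x : ℝ => Real.Gamma (1 - x)) (Icc a b) := by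
    intro x hx
    have h : ContinuousAt Real.Gamma (1 - x) := by
      refine (differentiableAt_Gamma fun m => ?_).continuousAt
      have := hx.2
      have hm : (0 : ℝ) ≤ m := m.cast_nonneg
      linarith
    exact (ContinuousAt.comp (f := fun x : ℝ => 1 - x) h (by fun_prop)).continuousWithinAt
  have hpow : Continuous fun x : ℝ => r ^ x := continuous_const_rpow hr.ne'
  have hsin : Continuous fun x : ℝ => Real.sin (x * π) := by fun_prop
  exact (hpow.mul hsin).continuousOn.mul hΓ

/-- `r ↦ exp (-(t * r)) * r ^ (-b)` is integrable on `(0, ∞)` for `b < 1` and `t > 0`. -/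
theorem integrableOn_exp_neg_mul_rpow_neg {b t : ℝ} (hb : b < 1) (ht : 0 < t) :
    IntegrableOn (fun r : ℝ => Real.exp (-(t * r)) * r ^ (-b)) (Ioi 0) := by
  have h := integrableOn_rpow_mul_exp_neg_mul_rpow (p := 1) (s := -b) (b := t)
    (by linarith) one_pos ht
  simpa only [rpow_one, neg_mul, mul_comm (Real.exp _)] using h

/-- The Laplace transform of `r ^ (-b)` for `b < 1`. -/
theorem integral_exp_neg_mul_rpow_neg {b t : ℝ} (hb : b < 1) (ht : 0 < t) :
    ∫ r in Ioi (0:ℝ), Real.exp (-(t * r)) * r ^ (-b) = Real.Gamma (1 - b) * t ^ (b - 1) := by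
  have h := integral_rpow_mul_exp_neg_mul_Ioi (a := 1 - b) (r := t) (by linarith) ht
  rw [one_div, inv_rpow ht.le, ← rpow_neg ht.le, neg_sub, show 1 - b - 1 = -b by ring] at h
  rw [mul_comm (Real.Gamma _), ← h]
  simp only [mul_comm]

/-- A lower bound for the imaginary part: `C ≤ A(r) (r ^ (-b) + r ^ (-a))`. -/
theorem setIntegral_sin_mul_Gamma_le {a b r : ℝ} {p : ℝ → ℝ} (ha : 0 < a) (hb : b < 1)
    (hr : 0 < r) (hp : ∀ x, 0 ≤ p x) (hpint : IntegrableOn p (Icc a b)) :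
    ∫ x in Icc a b, Real.sin (x * π) * Real.Gamma (1 - x) * p x ≤
      (∫ x in Icc a b, r ^ x * Real.sin (x * π) * Real.Gamma (1 - x) * p x) *
        (r ^ (-b) + r ^ (-a)) := by
  rw [← integral_mul_const]
  refine setIntegral_mono_on ?_
    ((integrableOn_rpow_mul_sin_mul_Gamma_mul hb hr hpint).mul_const _) measurableSet_Icc ?_
  · simpa only [one_rpow, one_mul] using integrableOn_rpow_mul_sin_mul_Gamma_mul hb one_pos hpint
  · intro x hx
    have hx0 : 0 < x := ha.trans_le hx.1
    have hx1 : x < 1 := hx.2.trans_lt hb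
    have hsin : 0 ≤ Real.sin (x * π) :=
      sin_nonneg_of_nonneg_of_le_pi (by positivity) (by nlinarith [pi_pos])
    have hΓ : 0 ≤ Real.Gamma (1 - x) := (Gamma_pos_of_pos (by linarith)).le
    have h := mul_le_mul_of_nonneg_left (one_le_rpow_mul_rpow_neg_add_rpow_neg hr hx.1 hx.2)
      (mul_nonneg (mul_nonneg hsin hΓ) (hp x))
    linarith

/-- Kochubei-type derivative bound. With
`A(r) = ∫₀¹ r^β sin(βπ) Γ(1−β) p(β) dβ`, `B(r) = ∫₀¹ r^β cos(βπ) Γ(1−β) p(β) dβ` and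
`C = ∫_{β₀}^{β₁} sin(βπ) Γ(1−β) p(β) dβ > 0`, one has, for all `λ, t > 0`,
`(λ/π) ∫₀^∞ e^{−tr} A(r)/((B(r)+λ)² + A(r)²) dr ≤ λ k(t)`, where
`k(t) = (Cπ)⁻¹ (Γ(1−β₁) t^{β₁−1} + Γ(1−β₀) t^{β₀−1})`. -/
theorem kochubei_derivative_bound
    (β₀ β₁ : ℝ) (h0 : 0 < β₀) (h01 : β₀ ≤ β₁) (h1 : β₁ < 1)
    (p : ℝ → ℝ) (hp : ∀ β, 0 ≤ p β) (hpint : IntegrableOn p (Ioo (0:ℝ) 1))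
    (hsupp : ∀ β : ℝ, β ∉ Icc β₀ β₁ → p β = 0)
    (hC : 0 < ∫ β in Icc β₀ β₁, Real.sin (β * π) * Real.Gamma (1 - β) * p β) :
    ∀ lam : ℝ, 0 < lam → ∀ t : ℝ, 0 < t →
      (lam / π) * ∫ r in Ioi (0:ℝ), Real.exp (-(t * r)) *
          (∫ β in Ioo (0:ℝ) 1, r ^ β * Real.sin (β * π) * Real.Gamma (1 - β) * p β) /
          (((∫ β in Ioo (0:ℝ) 1, r ^ β * Real.cos (β * π) * Real.Gamma (1 - β) * p β) + lam) ^ 2 +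
            (∫ β in Ioo (0:ℝ) 1, r ^ β * Real.sin (β * π) * Real.Gamma (1 - β) * p β) ^ 2) ≤
        lam * (((∫ β in Icc β₀ β₁, Real.sin (β * π) * Real.Gamma (1 - β) * p β) * π)⁻¹ *
          (Real.Gamma (1 - β₁) * t ^ (β₁ - 1) + Real.Gamma (1 - β₀) * t ^ (β₀ - 1))) := by
  intro lam hlam t ht
  set C := ∫ β in Icc β₀ β₁, Real.sin (β * π) * Real.Gamma (1 - β) * p β
  have hsub : Icc β₀ β₁ ⊆ Ioo (0:ℝ) 1 := fun x hx => ⟨h0.trans_le hx.1, hx.2.trans_lt h1⟩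
  have hA : ∀ r : ℝ, 0 < r →
      C ≤ (∫ β in Ioo (0:ℝ) 1, r ^ β * Real.sin (β * π) * Real.Gamma (1 - β) * p β) *
        (r ^ (-β₁) + r ^ (-β₀)) := by
    intro r hr
    rw [setIntegral_eq_of_subset_of_forall_sdiff_eq_zero measurableSet_Ioo hsub
      fun x hx => by rw [hsupp x hx.2, mul_zero]]
    exact setIntegral_sin_mul_Gamma_le h0 h1 hr hp (hpint.mono_set hsub)
  have hApos : ∀ r : ℝ, 0 < r →
      0 < ∫ β in Ioo (0:ℝ) 1, r ^ β * Real.sin (β * π) * Real.Gamma (1 - β) * p β := by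
    intro r hr
    exact pos_of_mul_pos_left (hC.trans_le (hA r hr)) (by positivity)
  have hi1 := integrableOn_exp_neg_mul_rpow_neg h1 ht
  have hi0 := integrableOn_exp_neg_mul_rpow_neg (h01.trans_lt h1) ht
  have hk : ∫ r in Ioi (0:ℝ), C⁻¹ * (Real.exp (-(t * r)) * r ^ (-β₁) +
        Real.exp (-(t * r)) * r ^ (-β₀)) =
      C⁻¹ * (Real.Gamma (1 - β₁) * t ^ (β₁ - 1) + Real.Gamma (1 - β₀) * t ^ (β₀ - 1)) := by
    rw [integral_const_mul, integral_add hi1 hi0, integral_exp_neg_mul_rpow_neg h1 ht,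
      integral_exp_neg_mul_rpow_neg (h01.trans_lt h1) ht]
  rw [mul_inv, mul_comm C⁻¹, mul_assoc, ← mul_assoc lam, ← div_eq_mul_inv, ← hk]
  refine mul_le_mul_of_nonneg_left (integral_mono_of_nonneg ?_ ((hi1.add hi0).const_mul _) ?_)
    (by positivity)
  · filter_upwards [ae_restrict_mem measurableSet_Ioi] with r hr
    have := hApos r hr
    simp only [Pi.zero_apply]
    positivity
  · filter_upwards [ae_restrict_mem measurableSet_Ioi] with r hr
    have hpos := hApos r hr
    have hle := hA r hr
    generalize (∫ β in Ioo (0:ℝ) 1, r ^ β * Real.sin (β * π) * Real.Gamma (1 - β) * p β) = A at *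
    generalize (∫ β in Ioo (0:ℝ) 1, r ^ β * Real.cos (β * π) * Real.Gamma (1 - β) * p β) = B at *
    calc Real.exp (-(t * r)) * A / ((B + lam) ^ 2 + A ^ 2)
        ≤ Real.exp (-(t * r)) * A / A ^ 2 := by
          gcongr
          linarith [sq_nonneg (B + lam)]
      _ = Real.exp (-(t * r)) * (1 / A) := by field_simp
      _ ≤ Real.exp (-(t * r)) * ((r ^ (-β₁) + r ^ (-β₀)) / C) := by
          refine mul_le_mul_of_nonneg_left ?_ (exp_pos _).le
          rw [div_le_div_iff₀ hpos hC]
          linarith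
      _ = C⁻¹ * (Real.exp (-(t * r)) * r ^ (-β₁) + Real.exp (-(t * r)) * r ^ (-β₀)) := by ring
end

section
/- Let 0 < β₀ ≤ β₁ < 1, let p : (0,1) → ℝ be a nonnegative integrable function vanishing outside [β₀,β₁], and assume C = ∫_{β₀}^{β₁} sin(βπ) Γ(1−β) p(β) dβ > 0. Define A(r) = ∫₀¹ r^β sin(βπ) Γ(1−β) p(β) dβ for r > 0. Then for every t > 0, π^{−1} ∫₀^∞ e^{−tr} / A(r) dr ≤ k(t), where k(t) = (Cπ)^{−1} ( Γ(1−β₁) t^{β₁−1} + Γ(1−β₀) t^{β₀−1} ). -/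
open MeasureTheory Set Real

/-- A lower bound for a weighted integral of powers by the smaller endpoint power. -/
theorem min_rpow_mul_setIntegral_le {a b r : ℝ} (hr : 0 < r) {w : ℝ → ℝ}
    (hw : ∀ x ∈ Icc a b, 0 ≤ w x) (hint : IntegrableOn w (Icc a b)) :
    min (r ^ a) (r ^ b) * ∫ x in Icc a b, w x ≤ ∫ x in Icc a b, r ^ x * w x := by
  rw [← integral_const_mul]
  refine setIntegral_mono_on (hint.const_mul _) ?_ measurableSet_Icc fun x hx => ?_
  · exact hint.continuousOn_mul (Real.continuous_const_rpow hr.ne').continuousOn isCompact_Icc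
  · refine mul_le_mul_of_nonneg_right ?_ (hw x hx)
    rcases le_total 1 r with h | h
    · exact (min_le_left _ _).trans (rpow_le_rpow_of_exponent_le h hx.1)
    · exact (min_le_right _ _).trans (rpow_le_rpow_of_exponent_ge hr h hx.2)

theorem inv_min_le_add_inv {x y : ℝ} (hx : 0 < x) (hy : 0 < y) : (min x y)⁻¹ ≤ x⁻¹ + y⁻¹ := by
  have := inv_pos.2 hx
  have := inv_pos.2 hy
  rcases min_choice x y with h | h <;> rw [h] <;> linarith

theorem integral_rpow_neg_mul_exp_neg_mul_Ioi {b t : ℝ} (hb : b < 1) (ht : 0 < t) :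
    ∫ r in Ioi (0 : ℝ), r ^ (-b) * Real.exp (-(t * r)) = Real.Gamma (1 - b) * t ^ (b - 1) := by
  have h := Real.integral_rpow_mul_exp_neg_mul_Ioi (sub_pos.2 hb) ht
  rw [sub_sub_cancel_left] at h
  rw [h, one_div, Real.inv_rpow ht.le, ← Real.rpow_neg ht.le, neg_sub, mul_comm]

theorem integrableOn_rpow_neg_mul_exp_neg_mul_Ioi {b t : ℝ} (hb : b < 1) (ht : 0 < t) :
    IntegrableOn (fun r : ℝ => r ^ (-b) * Real.exp (-(t * r))) (Ioi 0) := by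
  refine .of_integral_ne_zero ?_
  rw [integral_rpow_neg_mul_exp_neg_mul_Ioi hb ht]
  exact (mul_pos (Real.Gamma_pos_of_pos (sub_pos.2 hb)) (rpow_pos_of_pos ht _)).ne'

/-- with `A(r) = ∫₀¹ r^β sin(βπ) Γ(1−β) p(β) dβ` and
`C = ∫_{β₀}^{β₁} sin(βπ) Γ(1−β) p(β) dβ > 0`, for every `t > 0`,
`π⁻¹ ∫₀^∞ e^{−tr}/A(r) dr ≤ k(t) = (Cπ)⁻¹ (Γ(1−β₁) t^{β₁−1} + Γ(1−β₀) t^{β₀−1})`. -/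
theorem kochubei_l_bound
    (β₀ β₁ : ℝ) (h0 : 0 < β₀) (h01 : β₀ ≤ β₁) (h1 : β₁ < 1)
    (p : ℝ → ℝ) (hp : ∀ β, 0 ≤ p β) (hpint : IntegrableOn p (Ioo (0:ℝ) 1))
    (hsupp : ∀ β : ℝ, β ∉ Icc β₀ β₁ → p β = 0)
    (hC : 0 < ∫ β in Icc β₀ β₁, Real.sin (β * π) * Real.Gamma (1 - β) * p β) :
    ∀ t : ℝ, 0 < t →
      π⁻¹ * ∫ r in Ioi (0:ℝ), Real.exp (-(t * r)) /
          (∫ β in Ioo (0:ℝ) 1, r ^ β * Real.sin (β * π) * Real.Gamma (1 - β) * p β) ≤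
        ((∫ β in Icc β₀ β₁, Real.sin (β * π) * Real.Gamma (1 - β) * p β) * π)⁻¹ *
          (Real.Gamma (1 - β₁) * t ^ (β₁ - 1) + Real.Gamma (1 - β₀) * t ^ (β₀ - 1)) := by
  intro t ht
  set w : ℝ → ℝ := fun β => Real.sin (β * π) * Real.Gamma (1 - β) * p β with hw
  set C := ∫ β in Icc β₀ β₁, w β with hCdef
  have hw0 : ∀ β ∈ Icc β₀ β₁, 0 ≤ w β := fun β hβ => by
    have hsin : 0 ≤ Real.sin (β * π) :=
      Real.sin_nonneg_of_nonneg_of_le_pi (mul_nonneg (h0.le.trans hβ.1) pi_pos.le)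
        (mul_le_of_le_one_left pi_pos.le (hβ.2.trans h1.le))
    have hΓ : 0 < Real.Gamma (1 - β) := Real.Gamma_pos_of_pos (by linarith [hβ.2])
    exact mul_nonneg (mul_nonneg hsin hΓ.le) (hp β)
  have hwint : IntegrableOn w (Icc β₀ β₁) := .of_integral_ne_zero hC.ne'
  have hA : ∀ r : ℝ,
      ∫ β in Ioo (0:ℝ) 1, r ^ β * Real.sin (β * π) * Real.Gamma (1 - β) * p β =
        ∫ β in Icc β₀ β₁, r ^ β * w β := fun r => by
    rw [setIntegral_eq_of_subset_of_forall_sdiff_eq_zero measurableSet_Ioo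
      (Icc_subset_Ioo h0 h1) fun β hβ => by rw [hsupp β hβ.2, mul_zero]]
    simp only [hw, mul_assoc]
  simp only [hA]
  have hi₀ := integrableOn_rpow_neg_mul_exp_neg_mul_Ioi (h01.trans_lt h1) ht
  have hi₁ := integrableOn_rpow_neg_mul_exp_neg_mul_Ioi h1 ht
  rw [← integral_rpow_neg_mul_exp_neg_mul_Ioi h1 ht,
    ← integral_rpow_neg_mul_exp_neg_mul_Ioi (h01.trans_lt h1) ht, mul_inv_rev, mul_assoc,
    ← integral_add hi₁ hi₀, ← integral_const_mul C⁻¹]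
  refine mul_le_mul_of_nonneg_left ?_ (inv_nonneg.2 pi_pos.le)
  refine integral_mono_of_nonneg ?_ ((hi₁.add hi₀).const_mul _) ?_
  · filter_upwards [ae_restrict_mem measurableSet_Ioi] with r hr
    exact div_nonneg (Real.exp_pos _).le (setIntegral_nonneg measurableSet_Icc fun β hβ =>
      mul_nonneg (rpow_nonneg (le_of_lt hr) β) (hw0 β hβ))
  · filter_upwards [ae_restrict_mem measurableSet_Ioi] with r (hr : 0 < r)
    have hr₀ := rpow_pos_of_pos hr β₀
    have hr₁ := rpow_pos_of_pos hr β₁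
    calc Real.exp (-(t * r)) / ∫ β in Icc β₀ β₁, r ^ β * w β
        ≤ Real.exp (-(t * r)) / (min (r ^ β₀) (r ^ β₁) * C) :=
          div_le_div_of_nonneg_left (Real.exp_pos _).le (mul_pos (lt_min hr₀ hr₁) hC)
            (min_rpow_mul_setIntegral_le hr hw0 hwint)
      _ = C⁻¹ * (Real.exp (-(t * r)) * (min (r ^ β₀) (r ^ β₁))⁻¹) := by
          rw [div_eq_mul_inv, mul_inv]; ring
      _ ≤ C⁻¹ * (Real.exp (-(t * r)) * ((r ^ β₀)⁻¹ + (r ^ β₁)⁻¹)) := by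
          gcongr
          exact inv_min_le_add_inv hr₀ hr₁
      _ = C⁻¹ * (r ^ (-β₁) * Real.exp (-(t * r)) + r ^ (-β₀) * Real.exp (-(t * r))) := by
          rw [rpow_neg hr.le, rpow_neg hr.le]; ring
end

section
/- Let μ be a Borel measure on (0,1) with ∫_{(0,1)} (1−β)^{−1} dμ(β) < ∞, let 0 < β₀ ≤ β₁ < 1, let c₀, c₁ ≥ 0, and set k(s) = c₁ s^{β₁−1} + c₀ s^{β₀−1} for s > 0. Then for every t > 0, ∫_{(0,1)} ( ∫₀ᵗ k(s) (t−s)^{−β} ds ) dμ(β) < ∞. -/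
open MeasureTheory Set Real

/-- The lower integral of a nonnegative interval integrable function is its interval integral. -/
lemma setLIntegral_Ioo_ofReal_eq_intervalIntegral {f : ℝ → ℝ} {a b : ℝ} (hab : a ≤ b)
    (hf : IntervalIntegrable f volume a b) (hpos : ∀ s ∈ Ioo a b, 0 ≤ f s) :
    ∫⁻ s in Ioo a b, ENNReal.ofReal (f s) = ENNReal.ofReal (∫ s in a..b, f s) := by
  rw [intervalIntegral.integral_of_le hab, integral_Ioc_eq_integral_Ioo]
  refine (ofReal_integral_eq_lintegral_ofReal ?_ ?_).symm
  · exact ((intervalIntegrable_iff_integrableOn_Ioc_of_le hab).1 hf).mono_set Ioo_subset_Ioc_self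
  · exact (ae_restrict_iff' measurableSet_Ioo).2 (.of_forall hpos)

lemma setLIntegral_Ioo_rpow {a t : ℝ} (ha : 0 < a) (ht : 0 < t) :
    ∫⁻ s in Ioo 0 t, ENNReal.ofReal (s ^ (a - 1)) = ENNReal.ofReal (t ^ a / a) := by
  rw [setLIntegral_Ioo_ofReal_eq_intervalIntegral ht.le
    (intervalIntegral.intervalIntegrable_rpow' (by linarith))
    fun s hs => rpow_nonneg hs.1.le _, integral_rpow (.inl (by linarith))]
  simp [zero_rpow ha.ne']

lemma setLIntegral_Ioo_sub_rpow {a t : ℝ} (ha : 0 < a) (ht : 0 < t) :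
    ∫⁻ s in Ioo 0 t, ENNReal.ofReal ((t - s) ^ (a - 1)) = ENNReal.ofReal (t ^ a / a) := by
  have hint : IntervalIntegrable (fun s : ℝ => (t - s) ^ (a - 1)) volume 0 t := by
    have h : IntervalIntegrable (fun s : ℝ => s ^ (a - 1)) volume t 0 :=
      intervalIntegral.intervalIntegrable_rpow' (by linarith)
    simpa using h.comp_sub_left t
  rw [setLIntegral_Ioo_ofReal_eq_intervalIntegral ht.le hint
    fun s hs => rpow_nonneg (sub_nonneg.2 hs.2.le) _,
    intervalIntegral.integral_comp_sub_left (fun s : ℝ => s ^ (a - 1)) t, sub_self, sub_zero,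
    integral_rpow (.inl (by linarith))]
  simp [zero_rpow ha.ne']

/-- Splitting at the midpoint separates the two endpoint singularities of the Beta kernel. -/
lemma rpow_mul_sub_rpow_le {p q s t : ℝ} (hp : p ≤ 0) (hq : q ≤ 0) (hs : s ∈ Ioo 0 t) :
    s ^ p * (t - s) ^ q ≤ (t / 2) ^ q * s ^ p + (t / 2) ^ p * (t - s) ^ q := by
  obtain ⟨hs0, hst⟩ := hs
  have hts : 0 < t - s := sub_pos.2 hst
  have ht : 0 < t / 2 := by linarith
  have hsp := rpow_pos_of_pos hs0 p
  have htq := rpow_pos_of_pos hts q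
  have hhp := rpow_pos_of_pos ht p
  have hhq := rpow_pos_of_pos ht q
  rcases le_total s (t / 2) with h | h
  · have := rpow_le_rpow_of_nonpos ht (show t / 2 ≤ t - s by linarith) hq
    nlinarith [mul_le_mul_of_nonneg_right this hsp.le, mul_pos hhp htq]
  · have := rpow_le_rpow_of_nonpos ht h hp
    nlinarith [mul_le_mul_of_nonneg_right this htq.le, mul_pos hhq hsp]

/-- For fixed `a ∈ (0, 1]`, the Beta convolution integral is bounded by a multiple of
`(1 - β)⁻¹`, uniformly in `β`. -/
lemma exists_setLIntegral_rpow_mul_sub_rpow_le {a t : ℝ} (ha : 0 < a) (ha1 : a ≤ 1)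
    (ht : 0 < t) :
    ∃ C : ℝ, ∀ β ∈ Ioo (0 : ℝ) 1,
      ∫⁻ s in Ioo 0 t, ENNReal.ofReal (s ^ (a - 1) * (t - s) ^ (-β)) ≤
        ENNReal.ofReal C * ENNReal.ofReal ((1 - β)⁻¹) := by
  refine ⟨(1 + (t / 2)⁻¹) * (t ^ a / a) + (t / 2) ^ (a - 1) * (1 + t), fun β hβ => ?_⟩
  obtain ⟨hβ0, hβ1⟩ := hβ
  have hrpow_le : ∀ {x r : ℝ}, 0 < x → 0 ≤ r → r ≤ 1 → x ^ r ≤ 1 + x := by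
    intro x r hx hr hr1
    rcases le_total x 1 with h | h
    · linarith [rpow_le_one hx.le h hr]
    · have := rpow_le_rpow_of_exponent_le h hr1
      rw [rpow_one] at this
      linarith
  have h1β : 0 < 1 - β := sub_pos.2 hβ1
  have hhalf : 0 < t / 2 := half_pos ht
  have hta : 0 < t ^ a / a := div_pos (rpow_pos_of_pos ht a) ha
  have hhp : 0 < (t / 2) ^ (a - 1) := rpow_pos_of_pos hhalf _
  have hhq : 0 < (t / 2) ^ (-β) := rpow_pos_of_pos hhalf _
  have htβ : 0 < t ^ (1 - β) := rpow_pos_of_pos ht _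
  have hkernel : ∫⁻ s in Ioo 0 t, ENNReal.ofReal ((t - s) ^ (-β)) =
      ENNReal.ofReal (t ^ (1 - β) / (1 - β)) := by
    rw [← setLIntegral_Ioo_sub_rpow h1β ht]
    simp only [sub_sub_cancel_left]
  calc ∫⁻ s in Ioo 0 t, ENNReal.ofReal (s ^ (a - 1) * (t - s) ^ (-β))
      ≤ ∫⁻ s in Ioo 0 t, (ENNReal.ofReal ((t / 2) ^ (-β)) * ENNReal.ofReal (s ^ (a - 1)) +
          ENNReal.ofReal ((t / 2) ^ (a - 1)) * ENNReal.ofReal ((t - s) ^ (-β))) := by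
        refine setLIntegral_mono' measurableSet_Ioo fun s hs => ?_
        have hsp := rpow_nonneg hs.1.le (a - 1)
        have htq := rpow_nonneg (sub_nonneg.2 hs.2.le) (-β)
        rw [← ENNReal.ofReal_mul hhq.le, ← ENNReal.ofReal_mul hhp.le,
          ← ENNReal.ofReal_add (by positivity) (by positivity)]
        exact ENNReal.ofReal_le_ofReal
          (rpow_mul_sub_rpow_le (by linarith) (by linarith) hs)
    _ = ENNReal.ofReal ((t / 2) ^ (-β) * (t ^ a / a) +
          (t / 2) ^ (a - 1) * (t ^ (1 - β) / (1 - β))) := by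
        rw [lintegral_add_left (by fun_prop), lintegral_const_mul _ (by fun_prop),
          lintegral_const_mul _ (by fun_prop), setLIntegral_Ioo_rpow ha ht, hkernel,
          ← ENNReal.ofReal_mul hhq.le, ← ENNReal.ofReal_mul hhp.le,
          ← ENNReal.ofReal_add (by positivity) (by positivity)]
    _ ≤ _ := by
        rw [← ENNReal.ofReal_mul (by positivity), add_mul]
        refine ENNReal.ofReal_le_ofReal (add_le_add ?_ ?_)
        · have hle : (t / 2) ^ (-β) ≤ 1 + (t / 2)⁻¹ := by
            rw [rpow_neg hhalf.le, ← inv_rpow hhalf.le]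
            exact hrpow_le (inv_pos.2 hhalf) hβ0.le hβ1.le
          have hone : 1 ≤ (1 - β)⁻¹ := (one_le_inv₀ h1β).2 (by linarith)
          exact (mul_le_mul_of_nonneg_right hle hta.le).trans
            (le_mul_of_one_le_right (by positivity) hone)
        · rw [div_eq_mul_inv (t ^ (1 - β)), ← mul_assoc]
          have := hrpow_le ht h1β.le (by linarith)
          gcongr

/-- for a Borel measure `μ` on `(0,1)` with `∫ (1−β)⁻¹ dμ(β) < ∞`, and
`k(s) = c₁ s^{β₁−1} + c₀ s^{β₀−1}`, the double integral
`∫_{(0,1)} (∫₀ᵗ k(s)(t−s)^{−β} ds) dμ(β)` is finite for every `t > 0`. -/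
theorem distributed_order_convolution_finite
    (μ : Measure ℝ) (hμsupp : μ (Ioo (0:ℝ) 1)ᶜ = 0)
    (hμfin : ∫⁻ β, ENNReal.ofReal ((1 - β)⁻¹) ∂μ < ⊤)
    (β₀ β₁ : ℝ) (h0 : 0 < β₀) (h01 : β₀ ≤ β₁) (h1 : β₁ < 1)
    (c₀ c₁ : ℝ) (hc₀ : 0 ≤ c₀) (hc₁ : 0 ≤ c₁) :
    ∀ t : ℝ, 0 < t →
      ∫⁻ β, (∫⁻ s in Ioo (0:ℝ) t,
          ENNReal.ofReal ((c₁ * s ^ (β₁ - 1) + c₀ * s ^ (β₀ - 1)) * (t - s) ^ (-β))) ∂μ < ⊤ := by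
  intro t ht
  obtain ⟨C₁, hC₁⟩ := exists_setLIntegral_rpow_mul_sub_rpow_le (h0.trans_le h01) h1.le ht
  obtain ⟨C₀, hC₀⟩ := exists_setLIntegral_rpow_mul_sub_rpow_le h0 (h01.trans h1.le) ht
  have hmem : ∀ᵐ β ∂μ, β ∈ Ioo (0 : ℝ) 1 := mem_ae_iff.2 hμsupp
  have hbound : ∀ᵐ β ∂μ, ∫⁻ s in Ioo (0 : ℝ) t,
      ENNReal.ofReal ((c₁ * s ^ (β₁ - 1) + c₀ * s ^ (β₀ - 1)) * (t - s) ^ (-β)) ≤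
        (ENNReal.ofReal c₁ * ENNReal.ofReal C₁ + ENNReal.ofReal c₀ * ENNReal.ofReal C₀) *
          ENNReal.ofReal ((1 - β)⁻¹) := by
    filter_upwards [hmem] with β hβ
    calc _ = ∫⁻ s in Ioo (0 : ℝ) t,
          (ENNReal.ofReal c₁ * ENNReal.ofReal (s ^ (β₁ - 1) * (t - s) ^ (-β)) +
            ENNReal.ofReal c₀ * ENNReal.ofReal (s ^ (β₀ - 1) * (t - s) ^ (-β))) := by
          refine setLIntegral_congr_fun measurableSet_Ioo fun s hs => ?_
          have hs₁ := rpow_nonneg hs.1.le (β₁ - 1)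
          have hs₀ := rpow_nonneg hs.1.le (β₀ - 1)
          have hts := rpow_nonneg (sub_nonneg.2 hs.2.le) (-β)
          rw [← ENNReal.ofReal_mul hc₁, ← ENNReal.ofReal_mul hc₀,
            ← ENNReal.ofReal_add (by positivity) (by positivity), add_mul, mul_assoc, mul_assoc]
      _ ≤ _ := by
          rw [lintegral_add_left (by fun_prop), lintegral_const_mul _ (by fun_prop),
            lintegral_const_mul _ (by fun_prop), add_mul, mul_assoc, mul_assoc]
          gcongr
          · exact hC₁ β hβ
          · exact hC₀ β hβ
  refine (lintegral_mono_ae hbound).trans_lt ?_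
  rw [lintegral_const_mul' _ _ (by finiteness)]
  exact ENNReal.mul_lt_top (by finiteness) hμfin
end
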